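/- arXiv:2302.02313 — 5 statements merged into one kernel-verified Lean document; each statement's English description precedes it below -/
import Mathlib

section
/- Every Nash equilibrium of the Roman domination game is a strongly minimal Roman dominating function: if C is an NE, then C is an S-RDF. -/
open Finset

section Defs

variable {V : Type*} [Fintype V] [DecidableEq V] (G : SimpleGraph V) [DecidableRel G.Adj]

/-- The closed neighborhood `N̄ᵢ = Nᵢ ∪ {vᵢ}` of a vertex. -/
def closedNbhd (i : V) : Finset V := insert i (G.neighborFinset i)

/-- The graph has no isolated vertices. -/
def noIsolated : Prop := ∀ v : V, ∃ u : V, G.Adj v u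

/-- `m_j(C) = 1` if no vertex of `N̄_j` has value 2 under `C`, and `0` otherwise. -/
def mval (C : V → Fin 3) (j : V) : ℕ :=
  if ∀ k ∈ closedNbhd G j, C k ≠ 2 then 1 else 0

/-- The utility `u_i(C) = -λ1·c_i² - λ2·Σ_{j ∈ N̄ᵢ} (2 - c_j)·m_j(C)`. -/
def util (lam1 lam2 : ℝ) (C : V → Fin 3) (i : V) : ℝ :=
  -lam1 * ((C i : ℕ) : ℝ) ^ 2
    - lam2 * ∑ j ∈ closedNbhd G i, (2 - ((C j : ℕ) : ℝ)) * (mval G C j : ℝ)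

/-- The potential function `π(C) = -λ1·Σ_j c_j² - λ2·Σ_j (2 - c_j)·m_j(C)`. -/
def pot (lam1 lam2 : ℝ) (C : V → Fin 3) : ℝ :=
  -lam1 * ∑ j : V, ((C j : ℕ) : ℝ) ^ 2
    - lam2 * ∑ j : V, (2 - ((C j : ℕ) : ℝ)) * (mval G C j : ℝ)

/-- `C` is a Nash equilibrium: no unilateral deviation strictly improves a player's utility. -/
def isNE (lam1 lam2 : ℝ) (C : V → Fin 3) : Prop :=
  ∀ (i : V) (c : Fin 3),
    util G lam1 lam2 (Function.update C i c) i ≤ util G lam1 lam2 C i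

/-- `C` is a Roman dominating function. -/
def isRDF (C : V → Fin 3) : Prop :=
  ∀ v : V, C v = 0 → ∃ u : V, G.Adj v u ∧ C u = 2

/-- The weight `γ_R(G,C) = Σ_v C(v)`. -/
def weight (C : V → Fin 3) : ℕ := ∑ v : V, (C v : ℕ)

/-- Decrease a value in `{0,1,2}` by one (truncated at 0). -/
def decr (c : Fin 3) : Fin 3 := ⟨c.val - 1, lt_of_le_of_lt (Nat.sub_le _ _) c.isLt⟩

/-- `C` is a minimal RDF. -/
def isMRDF (C : V → Fin 3) : Prop :=
  isRDF G C ∧ ∀ i : V, 1 ≤ (C i : ℕ) → ¬ isRDF G (Function.update C i (decr (C i)))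

/-- `C` is a strongly minimal RDF. -/
def isSRDF (C : V → Fin 3) : Prop :=
  isMRDF G C ∧
    ¬ ∃ (C' : V → Fin 3) (i : V), isRDF G C' ∧ weight C' < weight C ∧
      C' i = 2 ∧ (∀ j : V, G.Adj i j → C j = 1 → C' j = 0) ∧
      (∀ k : V, k ≠ i → ¬(G.Adj i k ∧ C k = 1) → C' k = C k)

/-- `C` is a global minimum RDF. -/
def isGRDF (C : V → Fin 3) : Prop :=
  isRDF G C ∧ ∀ C' : V → Fin 3, isRDF G C' → weight C ≤ weight C'

/-- `Ñ_j(C)`: white neighbors of `v_j` for which `v_j` is the unique vertex of their closed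
neighborhood with value 2. -/
def tildeN (C : V → Fin 3) (j : V) : Finset V :=
  (G.neighborFinset j).filter
    (fun k => C k = 0 ∧ C j = 2 ∧ ∀ l ∈ closedNbhd G k, C l = 2 → l = j)

/-- `m_{i,j}(C) = 1` iff `Ñ_j(C) ⊆ N_i`. -/
def mij (C : V → Fin 3) (i j : V) : ℕ :=
  if tildeN G C j ⊆ G.neighborFinset i then 1 else 0

/-- `w_i(C) = Σ_{v_j ∈ N_i, c_j = 1} m_j(C) + 2·Σ_{v_j ∈ N_i, c_j = 2} m_{i,j}(C)`. -/
def wval (C : V → Fin 3) (i : V) : ℕ :=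
  ∑ j ∈ (G.neighborFinset i).filter (fun j => C j = 1), mval G C j
    + 2 * ∑ j ∈ (G.neighborFinset i).filter (fun j => C j = 2), mij G C i j

/-- The coalition `τ_i` of the private contract proposed by `v_i`. -/
def coalition (C : V → Fin 3) (i : V) : Finset V :=
  insert i ((G.neighborFinset i).filter
    (fun j => C j = 1 ∨ (C j = 2 ∧ mij G C i j = 1)))

/-- The contract profile: `v_i` takes value 2, the other coalition members take value 0. -/
def contract (C : V → Fin 3) (i : V) : V → Fin 3 :=
  fun k => if k = i then 2 else if k ∈ coalition G C i then 0 else C k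

end Defs

section Equilibrium

variable {V : Type*} [Fintype V] [DecidableEq V] {G : SimpleGraph V} [DecidableRel G.Adj]
  {lam1 lam2 : ℝ} {C : V → Fin 3}

theorem mem_closedNbhd {i j : V} : j ∈ closedNbhd G i ↔ j = i ∨ G.Adj i j := by
  simp [closedNbhd]

theorem mval_eq_zero {j k : V} (hk : k ∈ closedNbhd G j) (h : C k = 2) : mval G C j = 0 :=
  if_neg fun hall => hall k hk h

theorem mval_eq_one {j : V} (hj : C j ≠ 2) (h : ∀ k, G.Adj j k → C k ≠ 2) : mval G C j = 1 := by
  refine if_pos fun k hk => ?_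
  rcases mem_closedNbhd.1 hk with rfl | hk
  exacts [hj, h k hk]

theorem mval_le_one (j : V) : mval G C j ≤ 1 := by
  unfold mval
  split <;> simp

theorem mval_update {i : V} {c : Fin 3} (hi : C i ≠ 2) (hc : c ≠ 2) (j : V) :
    mval G (Function.update C i c) j = mval G C j := by
  have key : ∀ k, Function.update C i c k ≠ 2 ↔ C k ≠ 2 := by
    intro k
    by_cases hk : k = i
    · subst hk
      simp [hi, hc]
    · simp [hk]
  simp only [mval, key]

theorem util_update (i : V) (c : Fin 3) :
    util G lam1 lam2 (Function.update C i c) i =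
      -lam1 * ((c : ℕ) : ℝ) ^ 2 - lam2 * ((2 - ((c : ℕ) : ℝ)) *
        (mval G (Function.update C i c) i : ℝ) +
        ∑ j ∈ G.neighborFinset i, (2 - ((C j : ℕ) : ℝ)) *
          (mval G (Function.update C i c) j : ℝ)) := by
  unfold util closedNbhd
  rw [Finset.sum_insert (by simp)]
  simp only [Function.update_self]
  congr 3
  refine Finset.sum_congr rfl fun j hj => ?_
  rw [Function.update_of_ne (G.ne_of_adj ((G.mem_neighborFinset i j).1 hj)).symm]

theorem util_update_two (i : V) :
    util G lam1 lam2 (Function.update C i 2) i = -4 * lam1 := by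
  have hsum : ∑ j ∈ closedNbhd G i, (2 - ((Function.update C i 2 j : ℕ) : ℝ)) *
      (mval G (Function.update C i 2) j : ℝ) = 0 := by
    refine Finset.sum_eq_zero fun j hj => ?_
    have hij : i ∈ closedNbhd G j :=
      mem_closedNbhd.2 ((mem_closedNbhd.1 hj).imp Eq.symm fun h => h.symm)
    rw [mval_eq_zero hij (Function.update_self i 2 C)]
    simp
  rw [util, hsum, Function.update_self]
  norm_num
  ring

theorem util_update_of_ne_two {i : V} {c : Fin 3} (hi : C i ≠ 2) (hc : c ≠ 2) :
    util G lam1 lam2 (Function.update C i c) i =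
      -lam1 * ((c : ℕ) : ℝ) ^ 2 - lam2 * ((2 - ((c : ℕ) : ℝ)) * (mval G C i : ℝ) +
        ∑ j ∈ G.neighborFinset i, (2 - ((C j : ℕ) : ℝ)) * (mval G C j : ℝ)) := by
  rw [util_update]
  simp only [mval_update hi hc]

theorem util_of_ne_two {i : V} (hi : C i ≠ 2) :
    util G lam1 lam2 C i =
      -lam1 * ((C i : ℕ) : ℝ) ^ 2 - lam2 * ((2 - ((C i : ℕ) : ℝ)) * (mval G C i : ℝ) +
        ∑ j ∈ G.neighborFinset i, (2 - ((C j : ℕ) : ℝ)) * (mval G C j : ℝ)) := by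
  simpa using util_update_of_ne_two (lam1 := lam1) (lam2 := lam2) (G := G) hi hi

theorem isNE.isRDF (hlt : lam1 < lam2) (hNE : isNE G lam1 lam2 C) : isRDF G C := by
  intro v hv
  by_contra! hnone
  have hv2 : C v ≠ 2 := by simp [hv]
  have h := hNE v 1
  rw [util_update_of_ne_two hv2 (by decide), util_of_ne_two hv2,
    mval_eq_one hv2 hnone, hv] at h
  norm_num at h
  linarith

theorem isNE.not_two_of_adj_one (hpos : 0 < lam1) (hNE : isNE G lam1 lam2 C) {i j : V}
    (hi : C i = 1) (hij : G.Adj i j) : C j ≠ 2 := by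
  intro hj
  have hi2 : C i ≠ 2 := by simp [hi]
  have h := hNE i 0
  rw [util_update_of_ne_two hi2 (by decide), util_of_ne_two hi2,
    mval_eq_zero (mem_closedNbhd.2 (Or.inr hij)) hj, hi] at h
  norm_num at h
  linarith

theorem isNE.mval_of_eq_one (hpos : 0 < lam1) (hNE : isNE G lam1 lam2 C) {i : V}
    (hi : C i = 1) : mval G C i = 1 :=
  mval_eq_one (by simp [hi]) fun _ hk => hNE.not_two_of_adj_one hpos hi hk

theorem isNE.not_isRDF_update_one (hpos : 0 < lam2) (hlt : lam2 < 3 * lam1)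
    (hNE : isNE G lam1 lam2 C) {i : V} (hi : C i = 2) :
    ¬ _root_.isRDF G (Function.update C i 1) := by
  intro hR
  have h := hNE i 1
  have hsum : ∑ j ∈ G.neighborFinset i, (2 - ((C j : ℕ) : ℝ)) *
      (mval G (Function.update C i 1) j : ℝ) = 0 := by
    refine Finset.sum_eq_zero fun j hj => ?_
    have hij : G.Adj i j := (G.mem_neighborFinset i j).1 hj
    have hji : Function.update C i 1 j = C j := Function.update_of_ne hij.ne' _ _
    have hcases : C j = 0 ∨ C j = 1 ∨ C j = 2 := by
      generalize C j = c
      revert c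
      decide
    rcases hcases with h0 | h1 | h2
    · obtain ⟨u, hju, hu⟩ := hR j (hji.trans h0)
      rw [mval_eq_zero (mem_closedNbhd.2 (Or.inr hju)) hu]
      simp
    · exact absurd hi (hNE.not_two_of_adj_one (by linarith) h1 hij.symm)
    · simp [h2]
  have hC : util G lam1 lam2 C i = -4 * lam1 := by
    rw [← util_update_two (C := C) (lam2 := lam2) (G := G) i, ← hi, Function.update_eq_self]
  have hm : (mval G (Function.update C i 1) i : ℝ) ≤ 1 := by exact_mod_cast mval_le_one i
  rw [util_update, hsum, hC] at h
  norm_num at h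
  nlinarith

theorem isNE.isMRDF (hpos : 0 < lam2) (hlt : lam1 < lam2) (hlt' : lam2 < 3 * lam1)
    (hNE : isNE G lam1 lam2 C) : isMRDF G C := by
  refine ⟨hNE.isRDF hlt, fun i hi hR => ?_⟩
  have hcases : C i = 1 ∨ C i = 2 := by
    generalize C i = c at hi
    revert c
    decide
  rcases hcases with h1 | h2
  · rw [h1] at hR
    obtain ⟨u, hiu, hu⟩ := hR i (by rw [Function.update_self]; rfl)
    rw [Function.update_of_ne hiu.ne'] at hu
    exact hNE.not_two_of_adj_one (by linarith) h1 hiu hu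
  · rw [h2] at hR
    exact hNE.not_isRDF_update_one hpos hlt' h2 hR

theorem weight_add_card_add {C' : V → Fin 3} {i : V} (hi : C' i = 2)
    (hadj : ∀ j : V, G.Adj i j → C j = 1 → C' j = 0)
    (hrest : ∀ k : V, k ≠ i → ¬(G.Adj i k ∧ C k = 1) → C' k = C k) :
    weight C' + #{j ∈ G.neighborFinset i | C j = 1} + (C i : ℕ) = weight C + 2 := by
  have key : ∀ k : V, (C' k : ℕ) + (if G.Adj i k ∧ C k = 1 then 1 else 0) +
      (if k = i then (C i : ℕ) else 0) = (C k : ℕ) + (if k = i then 2 else 0) := by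
    intro k
    by_cases hk : k = i
    · subst hk
      simp [hi, add_comm]
    · by_cases hT : G.Adj i k ∧ C k = 1
      · simp [hk, hT, hadj k hT.1 hT.2]
      · simp [hk, hT, hrest k hk hT]
  have hcard : #{j ∈ G.neighborFinset i | C j = 1} =
      ∑ k : V, if G.Adj i k ∧ C k = 1 then 1 else 0 := by
    rw [← Finset.card_filter]
    congr 1
    ext j
    simp
  have hsum := Finset.sum_congr (rfl : (univ : Finset V) = univ) fun k _ => key k
  simp only [Finset.sum_add_distrib, Finset.sum_ite_eq', Finset.mem_univ, if_true] at hsum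
  rw [hcard]
  exact hsum

theorem isNE.card_le_sum (hpos : 0 < lam1) (hNE : isNE G lam1 lam2 C) (i : V) :
    (#{j ∈ G.neighborFinset i | C j = 1} : ℝ) ≤
      ∑ j ∈ G.neighborFinset i, (2 - ((C j : ℕ) : ℝ)) * (mval G C j : ℝ) := by
  rw [Finset.card_filter]
  push_cast
  refine Finset.sum_le_sum fun j _ => ?_
  split_ifs with hj
  · rw [hNE.mval_of_eq_one hpos hj, hj]
    norm_num
  · have hc : ((C j : ℕ) : ℝ) ≤ 2 := by exact_mod_cast Nat.le_of_lt_succ (C j).isLt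
    exact mul_nonneg (by linarith) (Nat.cast_nonneg _)

theorem isNE.card_add_le_two (hpos : 0 < lam1) (hlt : lam1 < 3 / 4 * lam2)
    (hNE : isNE G lam1 lam2 C) (i : V) :
    #{j ∈ G.neighborFinset i | C j = 1} + (C i : ℕ) ≤ 2 := by
  by_contra! hlarge
  have hcases : C i = 0 ∨ C i = 1 ∨ C i = 2 := by
    generalize C i = c
    revert c
    decide
  have h := hNE i 2
  have hcard := hNE.card_le_sum hpos i
  have hm : (0 : ℝ) ≤ mval G C i := Nat.cast_nonneg _
  rw [util_update_two] at h
  rcases hcases with h0 | h1 | h2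
  · have hge : (3 : ℝ) ≤ #{j ∈ G.neighborFinset i | C j = 1} := by
      rw [h0] at hlarge
      exact_mod_cast hlarge
    rw [util_of_ne_two (by simp [h0]), h0] at h
    norm_num at h
    nlinarith
  · have hge : (2 : ℝ) ≤ #{j ∈ G.neighborFinset i | C j = 1} := by
      rw [h1] at hlarge
      exact_mod_cast Nat.le_of_lt_succ hlarge
    rw [util_of_ne_two (by simp [h1]), hNE.mval_of_eq_one hpos h1, h1] at h
    norm_num at h
    nlinarith
  · rw [h2] at hlarge
    obtain ⟨j, hj⟩ := Finset.card_pos.1 (Nat.pos_of_lt_add_left hlarge)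
    obtain ⟨hij, hj1⟩ := Finset.mem_filter.1 hj
    exact hNE.not_two_of_adj_one hpos hj1 ((G.mem_neighborFinset i j).1 hij).symm h2

end Equilibrium

/-- Every Nash equilibrium of the Roman domination game is a strongly minimal
Roman dominating function. -/
theorem stmt5 {V : Type*} [Fintype V] [DecidableEq V] (G : SimpleGraph V)
    [DecidableRel G.Adj] (lam1 lam2 : ℝ)
    (h1 : 0 < 2 / 3 * lam2) (h2 : 2 / 3 * lam2 < lam1) (h3 : lam1 < 3 / 4 * lam2)
    (hiso : noIsolated G)
    (C : V → Fin 3) (hNE : isNE G lam1 lam2 C) :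
    isSRDF G C := by
  refine ⟨hNE.isMRDF (by linarith) (by linarith) (by linarith), ?_⟩
  rintro ⟨C', i, -, hlt, hi, hadj, hrest⟩
  have hweight := weight_add_card_add hi hadj hrest
  have hcard := hNE.card_add_le_two (by linarith) h3 i
  omega
end

section
/- Any strictly improving asynchronous play of the Roman domination game reaches a Nash equilibrium in at most (4λ1+2λ2)·n / min{3λ1−2λ2, −4λ1+3λ2} steps. Precisely: if C^(0), C^(1), …, C^(T) is a sequence of strategy profiles such that for each t < T there is a vertex v_{i_t} with C^(t+1) = (c', C^(t)_{−i_t}) for some c' ≠ C^(t)(v_{i_t}) and u_{i_t}(C^(t+1)) > u_{i_t}(C^(t)), then T ≤ (4λ1+2λ2)·n / min{3λ1−2λ2, −4λ1+3λ2}. -/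
open Finset

/-- The utility of a player is an integer combination of `lam1` and `lam2`. -/
lemma exists_int_util {V : Type*} [Fintype V] [DecidableEq V] (G : SimpleGraph V)
    [DecidableRel G.Adj] (lam1 lam2 : ℝ) (C : V → Fin 3) (i : V) :
    ∃ s : ℤ, util G lam1 lam2 C i = -lam1 * ((C i : ℕ) : ℝ) ^ 2 - lam2 * s :=
  ⟨∑ j ∈ closedNbhd G i, (2 - ((C j : ℕ) : ℤ)) * (mval G C j : ℤ), by
    simp only [util]; push_cast; rfl⟩

/-- An update at `i` only affects `mval` on the closed neighborhood of `i`. -/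
lemma mval_update_of_notMem {V : Type*} [Fintype V] [DecidableEq V] (G : SimpleGraph V)
    [DecidableRel G.Adj] (C : V → Fin 3) (i j : V) (c : Fin 3) (hj : j ∉ closedNbhd G i) :
    mval G (Function.update C i c) j = mval G C j := by
  have h (k : V) (hk : k ∈ closedNbhd G j) : k ≠ i := by
    rintro rfl
    simp only [closedNbhd, mem_insert, SimpleGraph.mem_neighborFinset] at hj hk
    exact hj (hk.imp Eq.symm SimpleGraph.Adj.symm)
  unfold mval
  refine if_congr (forall₂_congr fun k hk => ?_) rfl rfl
  rw [Function.update_of_ne (h k hk)]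

/-- `pot` is an exact potential. -/
lemma pot_update_sub {V : Type*} [Fintype V] [DecidableEq V] (G : SimpleGraph V)
    [DecidableRel G.Adj] (lam1 lam2 : ℝ) (C : V → Fin 3) (i : V) (c : Fin 3) :
    pot G lam1 lam2 (Function.update C i c) - pot G lam1 lam2 C
      = util G lam1 lam2 (Function.update C i c) i - util G lam1 lam2 C i := by
  have hsq (C' : V → Fin 3) : ∑ j, ((C' j : ℕ) : ℝ) ^ 2
      = ((C' i : ℕ) : ℝ) ^ 2 + ∑ j ∈ univ.erase i, ((C' j : ℕ) : ℝ) ^ 2 :=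
    (add_sum_erase _ _ (mem_univ i)).symm
  have hm (C' : V → Fin 3) : ∑ j, (2 - ((C' j : ℕ) : ℝ)) * (mval G C' j : ℝ)
      = ∑ j ∈ closedNbhd G i, (2 - ((C' j : ℕ) : ℝ)) * (mval G C' j : ℝ)
        + ∑ j ∈ (closedNbhd G i)ᶜ, (2 - ((C' j : ℕ) : ℝ)) * (mval G C' j : ℝ) :=
    (sum_add_sum_compl _ _).symm
  have hsq' : ∑ j ∈ univ.erase i, ((Function.update C i c j : ℕ) : ℝ) ^ 2
      = ∑ j ∈ univ.erase i, ((C j : ℕ) : ℝ) ^ 2 :=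
    sum_congr rfl fun j hj => by rw [Function.update_of_ne (ne_of_mem_erase hj)]
  have hm' : ∑ j ∈ (closedNbhd G i)ᶜ, (2 - ((Function.update C i c j : ℕ) : ℝ))
        * (mval G (Function.update C i c) j : ℝ)
      = ∑ j ∈ (closedNbhd G i)ᶜ, (2 - ((C j : ℕ) : ℝ)) * (mval G C j : ℝ) := by
    refine sum_congr rfl fun j hj => ?_
    rw [mem_compl] at hj
    have hji : j ≠ i := by
      rintro rfl
      exact hj (mem_insert_self _ _)
    rw [Function.update_of_ne hji, mval_update_of_notMem G C i j c hj]
  unfold pot util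
  rw [hsq C, hm C, hsq (Function.update C i c), hm (Function.update C i c), hsq', hm']
  ring

lemma min_le_of_int_combination {x y : ℝ} (hx : 2 / 3 * y < x) (hy : x < 3 / 4 * y)
    (a b : Fin 3) (hab : b ≠ a) (s t : ℤ)
    (h : -x * ((a : ℕ) : ℝ) ^ 2 - y * s < -x * ((b : ℕ) : ℝ) ^ 2 - y * t) :
    min (3 * x - 2 * y) (-4 * x + 3 * y)
      ≤ (-x * ((b : ℕ) : ℝ) ^ 2 - y * t) - (-x * ((a : ℕ) : ℝ) ^ 2 - y * s) := by
  have hy0 : 0 < y := by linarith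
  obtain ⟨d, rfl⟩ : ∃ d : ℤ, s = t + d := ⟨s - t, by ring⟩
  push_cast at h ⊢
  have lower (n : ℤ) (hn : y * n < y * (d + 1)) : y * n ≤ y * d := by
    have : (n : ℝ) < d + 1 := lt_of_mul_lt_mul_left hn hy0.le
    have : n < d + 1 := by exact_mod_cast this
    exact mul_le_mul_of_nonneg_left (by exact_mod_cast Int.lt_add_one_iff.mp this) hy0.le
  have l0 := lower 0
  have l1 := lower 1
  have l2 := lower (-2)
  have l3 := lower 3
  clear lower
  push_cast at l0 l1 l2 l3
  rw [min_le_iff]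
  fin_cases a <;> fin_cases b <;> first | exact absurd rfl hab | skip
  all_goals norm_num at h ⊢
  · right; linarith [l1 (by linarith)]
  · right; linarith [l3 (by linarith)]
  · left; linarith [l0 (by linarith)]
  · right; linarith [l3 (by linarith)]
  · left; linarith [l2 (by linarith)]
  · left; linarith [l2 (by linarith)]

lemma pot_nonpos {V : Type*} [Fintype V] [DecidableEq V] (G : SimpleGraph V)
    [DecidableRel G.Adj] {lam1 lam2 : ℝ} (h1 : 0 ≤ lam1) (h2 : 0 ≤ lam2) (C : V → Fin 3) :
    pot G lam1 lam2 C ≤ 0 := by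
  have hs : 0 ≤ ∑ j : V, ((C j : ℕ) : ℝ) ^ 2 := sum_nonneg fun j _ => sq_nonneg _
  have hm : 0 ≤ ∑ j : V, (2 - ((C j : ℕ) : ℝ)) * (mval G C j : ℝ) := by
    refine sum_nonneg fun j _ => mul_nonneg ?_ (Nat.cast_nonneg _)
    have : ((C j : ℕ) : ℝ) ≤ 2 := by exact_mod_cast Nat.le_of_lt_succ (C j).isLt
    linarith
  unfold pot
  nlinarith [mul_nonneg h1 hs, mul_nonneg h2 hm]

lemma le_pot {V : Type*} [Fintype V] [DecidableEq V] (G : SimpleGraph V)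
    [DecidableRel G.Adj] {lam1 lam2 : ℝ} (h1 : 0 ≤ lam1) (h2 : 0 ≤ lam2) (C : V → Fin 3) :
    -((4 * lam1 + 2 * lam2) * Fintype.card V) ≤ pot G lam1 lam2 C := by
  have hs : ∑ j : V, ((C j : ℕ) : ℝ) ^ 2 ≤ Fintype.card V * 4 := by
    rw [← nsmul_eq_mul]
    refine sum_le_card_nsmul _ _ _ fun j _ => ?_
    generalize C j = c
    fin_cases c <;> norm_num
  have hm : ∑ j : V, (2 - ((C j : ℕ) : ℝ)) * (mval G C j : ℝ) ≤ Fintype.card V * 2 := by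
    rw [← nsmul_eq_mul]
    refine sum_le_card_nsmul _ _ _ fun j _ => ?_
    have hc : (0 : ℝ) ≤ ((C j : ℕ) : ℝ) := Nat.cast_nonneg _
    unfold mval
    split_ifs <;> norm_num
  unfold pot
  nlinarith [mul_le_mul_of_nonneg_left hs h1, mul_le_mul_of_nonneg_left hm h2]

/-- Any strictly improving asynchronous play reaches a Nash equilibrium in at
most (4λ1+2λ2)·n / min{3λ1−2λ2, −4λ1+3λ2} steps. -/
theorem stmt11 {V : Type*} [Fintype V] [DecidableEq V] (G : SimpleGraph V)
    [DecidableRel G.Adj] (lam1 lam2 : ℝ)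
    (h1 : 0 < 2 / 3 * lam2) (h2 : 2 / 3 * lam2 < lam1) (h3 : lam1 < 3 / 4 * lam2)
    (hiso : noIsolated G)
    (T : ℕ) (Cs : ℕ → V → Fin 3)
    (hstep : ∀ t < T, ∃ (i : V) (c' : Fin 3), c' ≠ Cs t i ∧
      Cs (t + 1) = Function.update (Cs t) i c' ∧
      util G lam1 lam2 (Cs t) i < util G lam1 lam2 (Cs (t + 1)) i) :
    (T : ℝ) ≤ (4 * lam1 + 2 * lam2) * (Fintype.card V)
      / min (3 * lam1 - 2 * lam2) (-4 * lam1 + 3 * lam2) := by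
  have hgain (t : ℕ) (ht : t < T) : min (3 * lam1 - 2 * lam2) (-4 * lam1 + 3 * lam2)
      ≤ pot G lam1 lam2 (Cs (t + 1)) - pot G lam1 lam2 (Cs t) := by
    obtain ⟨i, c, hc, hCs, hu⟩ := hstep t ht
    rw [hCs] at hu ⊢
    rw [pot_update_sub]
    obtain ⟨s, hs⟩ := exists_int_util G lam1 lam2 (Cs t) i
    obtain ⟨s', hs'⟩ := exists_int_util G lam1 lam2 (Function.update (Cs t) i c) i
    rw [Function.update_self] at hs'
    rw [hs, hs'] at hu ⊢
    exact min_le_of_int_combination h2 h3 _ _ hc _ _ hu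
  have hsum := card_nsmul_le_sum (range T)
    (fun t => pot G lam1 lam2 (Cs (t + 1)) - pot G lam1 lam2 (Cs t)) _
    fun t ht => hgain t (mem_range.mp ht)
  rw [sum_range_sub (fun t => pot G lam1 lam2 (Cs t)), card_range, nsmul_eq_mul] at hsum
  have hlam1 : 0 ≤ lam1 := by linarith
  have hlam2 : 0 ≤ lam2 := by linarith
  rw [le_div_iff₀ (lt_min (by linarith) (by linarith))]
  linarith [pot_nonpos G hlam1 hlam2 (Cs T), le_pot G hlam1 hlam2 (Cs 0)]
end

section
/- Let C be a strategy profile and let I be a set of vertices whose closed neighborhoods are pairwise disjoint (N̄_i ∩ N̄_j = ∅ for all distinct v_i, v_j ∈ I). Let C' be a profile that agrees with C on every vertex outside I. Then π(C') − π(C) = Σ_{v_i ∈ I} ( u_i(C'(v_i), C_{−i}) − u_i(C) ). -/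
open Finset

theorem self_mem_closedNbhd {V : Type*} [Fintype V] [DecidableEq V] (G : SimpleGraph V)
    [DecidableRel G.Adj] (i : V) : i ∈ closedNbhd G i := by
  simp [closedNbhd]

theorem mem_closedNbhd_comm {V : Type*} [Fintype V] [DecidableEq V] (G : SimpleGraph V)
    [DecidableRel G.Adj] {i j : V} : i ∈ closedNbhd G j ↔ j ∈ closedNbhd G i := by
  simp only [closedNbhd, mem_insert, SimpleGraph.mem_neighborFinset, G.adj_comm i j, eq_comm]

theorem mval_congr {V : Type*} [Fintype V] [DecidableEq V] (G : SimpleGraph V)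
    [DecidableRel G.Adj] {C C' : V → Fin 3} {j : V}
    (h : ∀ k ∈ closedNbhd G j, C k = C' k) : mval G C j = mval G C' j := by
  unfold mval
  exact if_congr (forall₂_congr fun k hk => by rw [h k hk]) rfl rfl

/-- If I is a set of vertices with pairwise disjoint closed neighborhoods and C'
agrees with C outside I, then π(C') − π(C) = Σ_{v_i ∈ I} (u_i(C'(v_i), C_{−i}) − u_i(C)). -/
theorem stmt13 {V : Type*} [Fintype V] [DecidableEq V] (G : SimpleGraph V)
    [DecidableRel G.Adj] (lam1 lam2 : ℝ)
    (h1 : 0 < 2 / 3 * lam2) (h2 : 2 / 3 * lam2 < lam1) (h3 : lam1 < 3 / 4 * lam2)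
    (hiso : noIsolated G)
    (C C' : V → Fin 3) (I : Finset V)
    (hdisj : ∀ i ∈ I, ∀ j ∈ I, i ≠ j → Disjoint (closedNbhd G i) (closedNbhd G j))
    (hagree : ∀ k : V, k ∉ I → C' k = C k) :
    pot G lam1 lam2 C' - pot G lam1 lam2 C
      = ∑ i ∈ I, (util G lam1 lam2 (Function.update C i (C' i)) i - util G lam1 lam2 C i) := by
  have hsq : ∑ j : V, ((C' j : ℕ) : ℝ) ^ 2 - ∑ j : V, ((C j : ℕ) : ℝ) ^ 2
      = ∑ i ∈ I, (((C' i : ℕ) : ℝ) ^ 2 - ((C i : ℕ) : ℝ) ^ 2) := by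
    rw [← sum_sub_distrib]
    refine (sum_subset (subset_univ I) fun k _ hk => ?_).symm
    rw [hagree k hk, sub_self]
  have hupd : ∀ i ∈ I, ∀ j ∈ closedNbhd G i, ∀ k ∈ closedNbhd G j,
      Function.update C i (C' i) k = C' k := by
    intro i hi j hj k hk
    by_cases hki : k = i
    · subst hki
      simp
    · rw [Function.update_of_ne hki]
      refine (hagree k fun hkI => ?_).symm
      exact disjoint_left.mp (hdisj k hkI i hi hki) ((mem_closedNbhd_comm G).mp hk) hj
  have hdom : ∑ j : V, (2 - ((C' j : ℕ) : ℝ)) * (mval G C' j : ℝ)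
        - ∑ j : V, (2 - ((C j : ℕ) : ℝ)) * (mval G C j : ℝ)
      = ∑ i ∈ I, (∑ j ∈ closedNbhd G i, (2 - ((Function.update C i (C' i) j : ℕ) : ℝ))
            * (mval G (Function.update C i (C' i)) j : ℝ)
          - ∑ j ∈ closedNbhd G i, (2 - ((C j : ℕ) : ℝ)) * (mval G C j : ℝ)) := by
    rw [← sum_sub_distrib, ← sum_subset (subset_univ (I.biUnion (closedNbhd G))),
      sum_biUnion fun i hi j hj hij => hdisj i hi j hj hij]
    · refine sum_congr rfl fun i hi => ?_
      rw [← sum_sub_distrib]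
      refine sum_congr rfl fun j hj => ?_
      rw [mval_congr G (hupd i hi j hj), hupd i hi j hj j (self_mem_closedNbhd G j)]
    · intro j _ hj
      have hloc : ∀ k ∈ closedNbhd G j, C' k = C k := fun k hk => hagree k fun hkI =>
        hj (mem_biUnion.mpr ⟨k, hkI, (mem_closedNbhd_comm G).mp hk⟩)
      rw [mval_congr G hloc, hloc j (self_mem_closedNbhd G j), sub_self]
  calc pot G lam1 lam2 C' - pot G lam1 lam2 C
      = -lam1 * (∑ j : V, ((C' j : ℕ) : ℝ) ^ 2 - ∑ j : V, ((C j : ℕ) : ℝ) ^ 2)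
        - lam2 * (∑ j : V, (2 - ((C' j : ℕ) : ℝ)) * (mval G C' j : ℝ)
          - ∑ j : V, (2 - ((C j : ℕ) : ℝ)) * (mval G C j : ℝ)) := by
        unfold pot
        ring
    _ = _ := by
        rw [hsq, hdom, mul_sum, mul_sum, ← sum_sub_distrib]
        refine sum_congr rfl fun i _ => ?_
        unfold util
        rw [Function.update_self]
        ring
end

section
/- Let C be a strategy profile and v_i a vertex with c_i = 1, and let C' = (0, C_{−i}). If the change is strictly improving, i.e. u_i(C') > u_i(C), then the number of strongly dominated gray vertices decreases by exactly one and the number of free white vertices does not increase: |{v : C'(v)=1 and m_v(C')=0}| = |{v : C(v)=1 and m_v(C)=0}| − 1 and |{v : C'(v)=0 and m_v(C')=1}| ≤ |{v : C(v)=0 and m_v(C)=1}|. -/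
open Finset

theorem mval_update_of_ne_two {V : Type*} [Fintype V] [DecidableEq V] (G : SimpleGraph V)
    [DecidableRel G.Adj] {C : V → Fin 3} {i : V} {c : Fin 3} (hi : C i ≠ 2) (hc : c ≠ 2) (j : V) :
    mval G (Function.update C i c) j = mval G C j := by
  have h (k : V) : Function.update C i c k ≠ 2 ↔ C k ≠ 2 := by
    rcases eq_or_ne k i with rfl | hk
    · simp [hi, hc]
    · simp [hk]
  simp only [mval, h]

theorem mval_eq_zero_or_one {V : Type*} [Fintype V] [DecidableEq V] (G : SimpleGraph V)
    [DecidableRel G.Adj] (C : V → Fin 3) (j : V) : mval G C j = 0 ∨ mval G C j = 1 := by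
  unfold mval
  split_ifs <;> simp

theorem util_update_zero_of_eq_one {V : Type*} [Fintype V] [DecidableEq V] (G : SimpleGraph V)
    [DecidableRel G.Adj] (lam1 lam2 : ℝ) {C : V → Fin 3} {i : V} (hi : C i = 1) :
    util G lam1 lam2 (Function.update C i 0) i
      = util G lam1 lam2 C i + lam1 - lam2 * (mval G C i : ℝ) := by
  have hm := mval_update_of_ne_two G (C := C) (i := i) (c := 0) (by simp [hi]) (by simp)
  have hni : i ∉ G.neighborFinset i := by simp
  have hsum : ∑ j ∈ G.neighborFinset i,
        (2 - (((Function.update C i 0 j : Fin 3) : ℕ) : ℝ)) * (mval G C j : ℝ)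
      = ∑ j ∈ G.neighborFinset i, (2 - ((C j : ℕ) : ℝ)) * (mval G C j : ℝ) :=
    Finset.sum_congr rfl fun j hj => by
      rw [Function.update_of_ne (ne_of_mem_of_not_mem hj hni)]
  simp only [util, closedNbhd, Finset.sum_insert hni, hm, hsum, hi, Function.update_self]
  norm_num
  ring

/-- If c_i = 1 and changing it to 0 is strictly improving, then the number of
strongly dominated gray vertices decreases by exactly one and the number of free white
vertices does not increase. -/
theorem stmt18 {V : Type*} [Fintype V] [DecidableEq V] (G : SimpleGraph V)
    [DecidableRel G.Adj] (lam1 lam2 : ℝ)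
    (h1 : 0 < 2 / 3 * lam2) (h2 : 2 / 3 * lam2 < lam1) (h3 : lam1 < 3 / 4 * lam2)
    (hiso : noIsolated G)
    (C : V → Fin 3) (i : V) (hi : C i = 1)
    (himp : util G lam1 lam2 C i < util G lam1 lam2 (Function.update C i 0) i) :
    ((Finset.univ.filter
        (fun v => Function.update C i 0 v = 1 ∧ mval G (Function.update C i 0) v = 0)).card + 1
      = (Finset.univ.filter (fun v => C v = 1 ∧ mval G C v = 0)).card) ∧
    ((Finset.univ.filter
        (fun v => Function.update C i 0 v = 0 ∧ mval G (Function.update C i 0) v = 1)).card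
      ≤ (Finset.univ.filter (fun v => C v = 0 ∧ mval G C v = 1)).card) := by
  have hm := mval_update_of_ne_two G (C := C) (i := i) (c := 0) (by simp [hi]) (by simp)
  have hmi : mval G C i = 0 := by
    refine (mval_eq_zero_or_one G C i).resolve_right fun h => ?_
    rw [util_update_zero_of_eq_one G lam1 lam2 hi, h, Nat.cast_one] at himp
    linarith
  simp only [hm]
  constructor
  · rw [← Finset.card_insert_of_notMem (a := i) (by simp)]
    congr 1
    ext v
    rcases eq_or_ne v i with rfl | hv
    · simp [hi, hmi]
    · simp [hv]
  · refine Finset.card_le_card fun v => ?_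
    rcases eq_or_ne v i with rfl | hv
    · simp [hmi]
    · simp [hv]
end

section
/- Let C be a strategy profile and v_i a vertex with c_i = 0, and let C' = (1, C_{−i}). If the change is strictly improving, i.e. u_i(C') > u_i(C), then the number of free white vertices decreases by exactly one and the number of strongly dominated gray vertices does not decrease: |{v : C'(v)=0 and m_v(C')=1}| = |{v : C(v)=0 and m_v(C)=1}| − 1 and |{v : C'(v)=1 and m_v(C')=0}| ≥ |{v : C(v)=1 and m_v(C)=0}|. -/
open Finset

/-- Raising a vertex from `0` to `1` changes no value of `m`. -/
theorem mval_update_one {V : Type*} [Fintype V] [DecidableEq V]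
    (G : SimpleGraph V) [DecidableRel G.Adj] {C : V → Fin 3} {i : V} (hi : C i = 0) (j : V) : mval G (Function.update C i 1) j = mval G C j := by
  have h (k : V) : Function.update C i 1 k ≠ 2 ↔ C k ≠ 2 := by
    rcases eq_or_ne k i with rfl | hk
    · simp [hi]
    · simp [hk]
  simp only [mval, h]

/-- Raising a vertex from `0` to `1` costs `lam1` and gains `lam2` exactly when the vertex is
undominated. -/
theorem util_update_one {V : Type*} [Fintype V] [DecidableEq V] (G : SimpleGraph V)
    [DecidableRel G.Adj] (lam1 lam2 : ℝ) {C : V → Fin 3} {i : V} (hi : C i = 0) :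
    util G lam1 lam2 (Function.update C i 1) i
      = util G lam1 lam2 C i - lam1 + lam2 * mval G C i := by
  have hni : i ∉ G.neighborFinset i := by simp
  have hsum : ∑ j ∈ G.neighborFinset i,
        (2 - ((Function.update C i 1 j : ℕ) : ℝ)) * (mval G C j : ℝ)
      = ∑ j ∈ G.neighborFinset i, (2 - ((C j : ℕ) : ℝ)) * (mval G C j : ℝ) := by
    refine Finset.sum_congr rfl fun j hj => ?_
    rw [Function.update_of_ne (ne_of_mem_of_not_mem hj hni)]
  simp only [util, closedNbhd, mval_update_one G hi, Finset.sum_insert hni, hsum, hi,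
    Function.update_self]
  norm_num
  ring

/-- If c_i = 0 and changing it to 1 is strictly improving, then the number of
free white vertices decreases by exactly one and the number of strongly dominated gray
vertices does not decrease. -/
theorem stmt19 {V : Type*} [Fintype V] [DecidableEq V] (G : SimpleGraph V)
    [DecidableRel G.Adj] (lam1 lam2 : ℝ)
    (h1 : 0 < 2 / 3 * lam2) (h2 : 2 / 3 * lam2 < lam1) (h3 : lam1 < 3 / 4 * lam2)
    (hiso : noIsolated G)
    (C : V → Fin 3) (i : V) (hi : C i = 0)
    (himp : util G lam1 lam2 C i < util G lam1 lam2 (Function.update C i 1) i) :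
    ((Finset.univ.filter
        (fun v => Function.update C i 1 v = 0 ∧ mval G (Function.update C i 1) v = 1)).card + 1
      = (Finset.univ.filter (fun v => C v = 0 ∧ mval G C v = 1)).card) ∧
    ((Finset.univ.filter (fun v => C v = 1 ∧ mval G C v = 0)).card
      ≤ (Finset.univ.filter
        (fun v => Function.update C i 1 v = 1 ∧ mval G (Function.update C i 1) v = 0)).card) := by
  have hm : mval G C i = 1 := by
    rw [util_update_one G lam1 lam2 hi] at himp
    by_contra hne
    have h0 : mval G C i = 0 := by
      unfold mval at hne ⊢
      split_ifs at hne ⊢ <;> simp_all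
    rw [h0] at himp
    push_cast at himp
    linarith
  simp only [mval_update_one G hi]
  constructor
  · have hmem : i ∈ Finset.univ.filter (fun v => C v = 0 ∧ mval G C v = 1) := by simp [hi, hm]
    rw [← Finset.card_erase_add_one hmem]
    congr 2
    ext v
    rcases eq_or_ne v i with rfl | hv
    · simp
    · simp [hv]
  · refine Finset.card_le_card fun v hv => ?_
    simp only [Finset.mem_filter, Finset.mem_univ, true_and] at hv ⊢
    have hne : v ≠ i := by
      rintro rfl
      simp [hi] at hv
    rwa [Function.update_of_ne hne]
end
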